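/- arXiv:2603.00499 — 3 statements merged into one kernel-verified Lean document; each statement's English description precedes it below -/
import Mathlib

section
/- Let (X,d) be a metric space, let x = (x_n)_{n\ge1} be any sequence of points of X, let \alpha > 0 and \ell = (n^{-\alpha})_{n\ge1}. Then \{y \in X : \overline{H}(x,y) < 1/\alpha\} \subseteq U(x,\ell) \subseteq \{y \in X : \overline{H}(x,y) \le 1/\alpha\}. -/
open MeasureTheory Filter Metric ENNReal
open scoped Classical

/-- The first hitting time of the ball `B(y, r)` by the sequence `x`:
`τ(x, y, r) = inf {n ≥ 1 : xₙ ∈ B(y, r)}` (with `sInf ∅ = 0` as a junk value, unused,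
when no such `n` exists). -/
noncomputable def hittingTime {X : Type*} [MetricSpace X] (x : ℕ → X) (y : X) (r : ℝ) : ℕ :=
  sInf {n : ℕ | 1 ≤ n ∧ dist (x n) y < r}

/-- The upper hitting-time exponent `H̄(x, y) = limsup_{r → 0⁺} log τ(x, y, r) / (- log r)`,
set to `∞` if `τ(x, y, r) = ∞` for some `r > 0`. -/
noncomputable def upperHitExp {X : Type*} [MetricSpace X] (x : ℕ → X) (y : X) : ℝ≥0∞ :=
  if ∀ r : ℝ, 0 < r → ∃ n : ℕ, 1 ≤ n ∧ dist (x n) y < r then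
    Filter.limsup
      (fun r : ℝ => ENNReal.ofReal (Real.log (hittingTime x y r) / (-Real.log r)))
      (nhdsWithin 0 (Set.Ioi 0))
  else ⊤

theorem hittingTime_mem {X : Type*} [MetricSpace X] {x : ℕ → X} {y : X} {r : ℝ}
    (h : ∃ n : ℕ, 1 ≤ n ∧ dist (x n) y < r) :
    1 ≤ hittingTime x y r ∧ dist (x (hittingTime x y r)) y < r :=
  Nat.sInf_mem (s := {n : ℕ | 1 ≤ n ∧ dist (x n) y < r}) h

theorem tendsto_natCast_rpow_neg_nhdsGT {α : ℝ} (hα : 0 < α) :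
    Tendsto (fun N : ℕ => (N : ℝ) ^ (-α)) atTop (nhdsWithin 0 (Set.Ioi 0)) := by
  refine tendsto_nhdsWithin_iff.2
    ⟨(tendsto_rpow_neg_atTop hα).comp tendsto_natCast_atTop_atTop, ?_⟩
  filter_upwards [eventually_gt_atTop 0] with N hN
  exact Real.rpow_pos_of_pos (Nat.cast_pos.2 hN) _

theorem eventually_exists_dist_lt_of_upperHitExp_lt {X : Type*} [MetricSpace X] {x : ℕ → X}
    {y : X} {α : ℝ} (hα : 0 < α) (hy : upperHitExp x y < ENNReal.ofReal (1 / α)) :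
    ∀ᶠ N : ℕ in atTop, ∃ n, 1 ≤ n ∧ n ≤ N ∧ dist (x n) y < (N : ℝ) ^ (-α) := by
  unfold upperHitExp at hy
  split_ifs at hy with h
  · have hlt := (tendsto_natCast_rpow_neg_nhdsGT hα).eventually (eventually_lt_of_limsup_lt hy)
    filter_upwards [hlt, eventually_gt_atTop 1] with N hN hN1
    have hN1' : (1 : ℝ) < N := by exact_mod_cast hN1
    have hN0 : (0 : ℝ) < N := by linarith
    obtain ⟨h1, hd⟩ := hittingTime_mem (h _ (Real.rpow_pos_of_pos hN0 (-α)))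
    refine ⟨_, h1, ?_, hd⟩
    rw [ENNReal.ofReal_lt_ofReal_iff (by positivity), Real.log_rpow hN0, neg_mul, neg_neg,
      div_lt_div_iff₀ (mul_pos hα (Real.log_pos hN1')) hα, one_mul, mul_comm,
      mul_lt_mul_iff_right₀ hα,
      Real.log_lt_log_iff (by exact_mod_cast h1) hN0] at hN
    exact_mod_cast hN.le
  · exact absurd hy not_top_lt

theorem exists_dist_lt_of_eventually {X : Type*} [MetricSpace X] {x : ℕ → X} {y : X} {α : ℝ}
    (hα : 0 < α)
    (hy : ∀ᶠ N : ℕ in atTop, ∃ n, 1 ≤ n ∧ n ≤ N ∧ dist (x n) y < (N : ℝ) ^ (-α))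
    (r : ℝ) (hr : 0 < r) : ∃ n : ℕ, 1 ≤ n ∧ dist (x n) y < r := by
  have hlt := (tendsto_nhdsWithin_iff.1 (tendsto_natCast_rpow_neg_nhdsGT hα)).1.eventually_lt_const hr
  obtain ⟨N, ⟨n, h1, -, hd⟩, hN⟩ := (hy.and hlt).exists
  exact ⟨n, h1, hd.trans hN⟩

theorem eventually_hittingTime_le {X : Type*} [MetricSpace X] {x : ℕ → X} {y : X} {α : ℝ}
    (hα : 0 < α)
    (hy : ∀ᶠ N : ℕ in atTop, ∃ n, 1 ≤ n ∧ n ≤ N ∧ dist (x n) y < (N : ℝ) ^ (-α)) :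
    ∀ᶠ r : ℝ in nhdsWithin 0 (Set.Ioi 0), (hittingTime x y r : ℝ) ≤ 2 * r ^ (-(1 / α)) := by
  have hbase : Tendsto (fun r : ℝ => r ^ (-(1 / α))) (nhdsWithin 0 (Set.Ioi 0)) atTop :=
    tendsto_rpow_neg_nhdsGT_zero (by simpa using hα)
  have hN : Tendsto (fun r : ℝ => ⌊r ^ (-(1 / α))⌋₊ + 1) (nhdsWithin 0 (Set.Ioi 0)) atTop :=
    tendsto_atTop_mono (fun _ => Nat.le_succ _) (tendsto_nat_floor_atTop.comp hbase)
  filter_upwards [hN.eventually hy, hbase.eventually_ge_atTop 1, self_mem_nhdsWithin]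
    with r ⟨n, h1, hn, hd⟩ hr1 (hr : 0 < r)
  have hpow : ((⌊r ^ (-(1 / α))⌋₊ + 1 : ℕ) : ℝ) ^ (-α) ≤ r := by
    calc ((⌊r ^ (-(1 / α))⌋₊ + 1 : ℕ) : ℝ) ^ (-α) ≤ (r ^ (-(1 / α))) ^ (-α) := by
          refine Real.rpow_le_rpow_of_nonpos (by positivity) ?_ (by linarith)
          push_cast
          exact (Nat.lt_floor_add_one _).le
      _ = r := by
          rw [← Real.rpow_mul hr.le, neg_mul_neg, one_div_mul_cancel hα.ne', Real.rpow_one]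
  have hτ : hittingTime x y r ≤ ⌊r ^ (-(1 / α))⌋₊ + 1 :=
    (Nat.sInf_le ⟨h1, hd.trans_le hpow⟩ : hittingTime x y r ≤ n).trans hn
  have hτ' : (hittingTime x y r : ℝ) ≤ ⌊r ^ (-(1 / α))⌋₊ + 1 := by exact_mod_cast hτ
  have hfloor := Nat.floor_le (zero_le_one.trans hr1)
  linarith

theorem upperHitExp_le_of_eventually {X : Type*} [MetricSpace X] {x : ℕ → X} {y : X} {α : ℝ}
    (hα : 0 < α)
    (hy : ∀ᶠ N : ℕ in atTop, ∃ n, 1 ≤ n ∧ n ≤ N ∧ dist (x n) y < (N : ℝ) ^ (-α)) :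
    upperHitExp x y ≤ ENNReal.ofReal (1 / α) := by
  have h := exists_dist_lt_of_eventually hα hy
  have hlog : Tendsto (fun r : ℝ => -Real.log r) (nhdsWithin 0 (Set.Ioi 0)) atTop :=
    tendsto_neg_atBot_atTop.comp Real.tendsto_log_nhdsGT_zero
  have hlim : Tendsto (fun r : ℝ => ENNReal.ofReal (Real.log 2 / (-Real.log r) + 1 / α))
      (nhdsWithin 0 (Set.Ioi 0)) (nhds (ENNReal.ofReal (1 / α))) :=
    (ENNReal.continuous_ofReal.tendsto _).comp
      (by simpa using (hlog.const_div_atTop (Real.log 2)).add_const (1 / α))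
  rw [upperHitExp, if_pos h, ← hlim.limsup_eq]
  refine limsup_le_limsup ?_
  filter_upwards [eventually_hittingTime_le hα hy, hlog.eventually_gt_atTop 0,
    self_mem_nhdsWithin] with r hτ hr0 (hr : 0 < r)
  refine ENNReal.ofReal_le_ofReal ?_
  have hτ0 : (0 : ℝ) < hittingTime x y r := by exact_mod_cast (hittingTime_mem (h r hr)).1
  have hle := Real.log_le_log hτ0 hτ
  rw [Real.log_mul two_ne_zero (Real.rpow_pos_of_pos hr _).ne', Real.log_rpow hr] at hle
  rw [div_add' _ _ _ hr0.ne']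
  gcongr
  linarith

/-- Lemma 5.2: for `ℓ = (n^{-α})ₙ` with `α > 0` and any sequence `x` of points of a metric
space, `{y : H̄(x, y) < 1/α} ⊆ U(x, ℓ) ⊆ {y : H̄(x, y) ≤ 1/α}`. -/
theorem stmt9 {X : Type*} [MetricSpace X] (x : ℕ → X) (α : ℝ) (hα : 0 < α) :
    {y : X | upperHitExp x y < ENNReal.ofReal (1 / α)}
        ⊆ {y : X | ∀ᶠ N in atTop, ∃ n, 1 ≤ n ∧ n ≤ N ∧ dist (x n) y < (N : ℝ) ^ (-α)} ∧
    {y : X | ∀ᶠ N in atTop, ∃ n, 1 ≤ n ∧ n ≤ N ∧ dist (x n) y < (N : ℝ) ^ (-α)}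
        ⊆ {y : X | upperHitExp x y ≤ ENNReal.ofReal (1 / α)} := by
  exact ⟨fun _ => eventually_exists_dist_lt_of_upperHitExp_lt hα,
    fun _ => upperHitExp_le_of_eventually hα⟩
end

section
/- Let \theta > 1, c > 0, and let l \le q be positive integers with (2c)^d < \theta^{l+1}. For j \ge l set A_j = \big(1 - (2c)^d\,\theta^{-(j+1)}\big)^{\theta^{j-1}(\theta-1)} (real power), and for t \in \mathbb{T}^d define \Psi_{l,q}(t) = \prod_{j=l}^{q}\Big(1 + \frac{A_j}{1-A_j}\,\mathbf{1}_{\{\lVert t\rVert < c\,\theta^{-(j+1)/d}\}}\Big). Set s(c,\theta) = \frac{-d\,\log\big(1 - e^{-(2c)^d(\theta-1)/\theta^2}\big)}{\log\theta} and C_l = c^{s(c,\theta)}\big(1 - e^{-(2c)^d(\theta-1)/\theta^2}\big)^{l}. Then for every t \in \mathbb{T}^d with t \ne 0, \Psi_{l,q}(t) \le 1 + C_l\,\lVert t\rVert^{-s(c,\theta)}. -/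
open MeasureTheory Metric Finset

/-- If the factors with index at least `l` lie in `[0, p⁻¹]` and each of them is either `1` or has
an index `j` with `p⁻¹ ^ (j + 1) ≤ R`, then their product is at most `1 + R * p ^ l`. -/
theorem prod_Icc_le_one_add {l q : ℕ} (hlq : l ≤ q) {g : ℕ → ℝ} {p R : ℝ} (hp : 0 < p)
    (hR : 0 ≤ R) (hg0 : ∀ j, l ≤ j → 0 ≤ g j) (hgp : ∀ j, l ≤ j → g j ≤ p⁻¹)
    (hg : ∀ j, l ≤ j → g j = 1 ∨ p⁻¹ ^ (j + 1) ≤ R) :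
    ∏ j ∈ Finset.Icc l q, g j ≤ 1 + R * p ^ l := by
  have large : ∀ n, l ≤ n → p⁻¹ ^ (n + 1) ≤ R →
      ∏ j ∈ Finset.Icc l n, g j ≤ 1 + R * p ^ l := by
    intro n hn h
    calc ∏ j ∈ Finset.Icc l n, g j ≤ ∏ _j ∈ Finset.Icc l n, p⁻¹ :=
          Finset.prod_le_prod (fun j hj => hg0 j (Finset.mem_Icc.1 hj).1)
            (fun j hj => hgp j (Finset.mem_Icc.1 hj).1)
      _ = p⁻¹ ^ (n + 1 - l) := by simp
      _ = p⁻¹ ^ (n + 1) * p ^ l := by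
          rw [inv_pow, inv_pow, inv_mul_eq_div, eq_div_iff (by positivity), inv_mul_eq_iff_eq_mul₀
            (by positivity), ← pow_add]
          congr 1
          omega
      _ ≤ R * p ^ l := by gcongr
      _ ≤ 1 + R * p ^ l := by linarith
  induction q, hlq using Nat.le_induction with
  | base =>
    rcases hg l le_rfl with h | h
    · simp only [Finset.Icc_self, Finset.prod_singleton, h]
      have : 0 ≤ R * p ^ l := by positivity
      linarith
    · exact large l le_rfl h
  | succ n hn ih =>
    rcases hg (n + 1) (by omega) with h | h
    · rwa [Finset.prod_Icc_succ_top (by omega), h, mul_one]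
    · exact large (n + 1) (by omega) h

/-- The elementary bound `(1 - x) ^ N ≤ exp (-(x * N))` for real powers. -/
theorem one_sub_rpow_le_exp_neg_mul {x N : ℝ} (hx : x ≤ 1) (hN : 0 ≤ N) :
    (1 - x) ^ N ≤ Real.exp (-(x * N)) := by
  calc (1 - x) ^ N ≤ Real.exp (-x) ^ N :=
        Real.rpow_le_rpow (by linarith) (Real.one_sub_le_exp_neg x) hN
    _ = Real.exp (-(x * N)) := by rw [← Real.exp_mul, neg_mul]

/-- With `s = -d log p / log θ`, a point at distance `r < c θ ^ (-(j + 1) / d)` satisfies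
`p⁻¹ ^ (j + 1) ≤ c ^ s * r ^ (-s)`. -/
theorem inv_pow_succ_le_rpow_mul_rpow_neg {d : ℕ} (hd : 1 ≤ d) {θ c p r : ℝ} (hθ : 1 < θ)
    (hc : 0 < c) (hp : 0 < p) (hp1 : p < 1) (hr : 0 < r) {j : ℕ}
    (h : r < c * θ ^ (-((j : ℝ) + 1) / (d : ℝ))) :
    p⁻¹ ^ (j + 1) ≤ c ^ (-(d : ℝ) * Real.log p / Real.log θ)
      * r ^ (-(-(d : ℝ) * Real.log p / Real.log θ)) := by
  have hd0 : (0 : ℝ) < d := by exact_mod_cast hd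
  have hlogθ : 0 < Real.log θ := Real.log_pos hθ
  have hlogp : Real.log p < 0 := Real.log_neg hp hp1
  have hθ0 : 0 < θ := by linarith
  have hlog : Real.log r ≤ Real.log c + -((j : ℝ) + 1) / d * Real.log θ := by
    rw [← Real.log_rpow hθ0, ← Real.log_mul hc.ne' (by positivity)]
    exact Real.log_le_log hr h.le
  have hs : 0 ≤ -(d : ℝ) * Real.log p / Real.log θ :=
    div_nonneg (by nlinarith) hlogθ.le
  rw [← Real.log_le_log_iff (by positivity) (by positivity),
    Real.log_mul (by positivity) (by positivity), Real.log_rpow hc, Real.log_rpow hr,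
    Real.log_pow, Real.log_inv]
  have key : -(d : ℝ) * Real.log p / Real.log θ * (-((j : ℝ) + 1) / d * Real.log θ)
      = ((j : ℝ) + 1) * Real.log p := by
    field_simp
  have := mul_le_mul_of_nonneg_left hlog hs
  push_cast
  linarith

/-- Lemma 6.7 (Lemma 4.3): on the `d`-torus `𝕋^d = (ℝ/ℤ)^d` with the max-norm metric, let
`θ > 1`, `c > 0`, `l ≤ q` with `(2c)^d < θ^{l+1}`, and for `j ≥ l` set
`A_j = (1 - (2c)^d θ^{-(j+1)})^{θ^{j-1}(θ-1)}` and
`Ψ_{l,q}(t) = ∏_{j=l}^q (1 + A_j/(1-A_j) · 1_{‖t‖ < c θ^{-(j+1)/d}})`. Then for `t ≠ 0`,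
`Ψ_{l,q}(t) ≤ 1 + C_l ‖t‖^{-s(c,θ)}` with
`s(c,θ) = -d log(1 - e^{-(2c)^d(θ-1)/θ²}) / log θ` and
`C_l = c^{s(c,θ)} (1 - e^{-(2c)^d(θ-1)/θ²})^l`. -/
theorem stmt18 (d : ℕ) (hd : 1 ≤ d) (θ c : ℝ) (hθ : 1 < θ) (hc : 0 < c)
    (l q : ℕ) (hl : 1 ≤ l) (hlq : l ≤ q) (hsmall : (2 * c) ^ d < θ ^ (l + 1))
    (t : Fin d → UnitAddCircle) (ht : t ≠ 0) :
    (∏ j ∈ Finset.Icc l q,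
        (1 + ((1 - (2 * c) ^ d * θ ^ (-((j : ℝ) + 1))) ^ (θ ^ ((j : ℝ) - 1) * (θ - 1)))
            / (1 - (1 - (2 * c) ^ d * θ ^ (-((j : ℝ) + 1))) ^ (θ ^ ((j : ℝ) - 1) * (θ - 1)))
            * (if ‖t‖ < c * θ ^ (-((j : ℝ) + 1) / (d : ℝ)) then (1 : ℝ) else 0)))
      ≤ 1 + (c ^ (-(d : ℝ) * Real.log (1 - Real.exp (-((2 * c) ^ d * (θ - 1) / θ ^ 2)))
              / Real.log θ)
            * (1 - Real.exp (-((2 * c) ^ d * (θ - 1) / θ ^ 2))) ^ l)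
          * ‖t‖ ^ (-(-(d : ℝ) * Real.log (1 - Real.exp (-((2 * c) ^ d * (θ - 1) / θ ^ 2)))
              / Real.log θ)) := by
  have hθ0 : 0 < θ := by linarith
  have hE : Real.exp (-((2 * c) ^ d * (θ - 1) / θ ^ 2)) < 1 := by
    have : 0 < θ - 1 := by linarith
    rw [Real.exp_lt_one_iff, neg_lt_zero]
    positivity
  have hE0 := Real.exp_pos (-((2 * c) ^ d * (θ - 1) / θ ^ 2))
  have hr : 0 < ‖t‖ := norm_pos_iff.2 ht
  have hA : ∀ j : ℕ, l ≤ j →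
      0 ≤ (1 - (2 * c) ^ d * θ ^ (-((j : ℝ) + 1))) ^ (θ ^ ((j : ℝ) - 1) * (θ - 1)) ∧
      (1 - (2 * c) ^ d * θ ^ (-((j : ℝ) + 1))) ^ (θ ^ ((j : ℝ) - 1) * (θ - 1))
        ≤ Real.exp (-((2 * c) ^ d * (θ - 1) / θ ^ 2)) := by
    intro j hj
    have hx : (2 * c) ^ d * θ ^ (-((j : ℝ) + 1)) ≤ 1 := by
      rw [Real.rpow_neg hθ0.le, ← div_eq_mul_inv, div_le_one (by positivity)]
      have : θ ^ (l + 1) ≤ θ ^ (j + 1) := pow_le_pow_right₀ hθ.le (by omega)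
      calc (2 * c) ^ d ≤ θ ^ (j + 1) := hsmall.le.trans this
        _ = θ ^ ((j : ℝ) + 1) := by rw [← Real.rpow_natCast]; push_cast; rfl
    have hN : 0 ≤ θ ^ ((j : ℝ) - 1) * (θ - 1) := mul_nonneg (by positivity) (by linarith)
    refine ⟨Real.rpow_nonneg (by linarith) _, (one_sub_rpow_le_exp_neg_mul hx hN).trans_eq ?_⟩
    have hpow : θ ^ (-((j : ℝ) + 1)) * θ ^ ((j : ℝ) - 1) = (θ ^ 2)⁻¹ := by
      rw [← Real.rpow_add hθ0, ← Real.rpow_natCast, ← Real.rpow_neg hθ0.le]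
      congr 1
      push_cast
      ring
    congr 2
    rw [div_eq_mul_inv, ← hpow]
    ring
  generalize Real.exp (-((2 * c) ^ d * (θ - 1) / θ ^ 2)) = E at hA hE hE0 ⊢
  have hp : 0 < 1 - E := by linarith
  have hone : 1 ≤ (1 - E)⁻¹ := (one_le_inv₀ hp).2 (by linarith)
  rw [mul_right_comm]
  refine prod_Icc_le_one_add hlq hp (by positivity) ?_ ?_ ?_
  · intro j hj
    obtain ⟨h0, h1⟩ := hA j hj
    have := div_nonneg h0 (sub_nonneg.2 (h1.trans hE.le))
    split_ifs <;> linarith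
  · intro j hj
    obtain ⟨h0, h1⟩ := hA j hj
    generalize (1 - (2 * c) ^ d * θ ^ (-((j : ℝ) + 1))) ^ (θ ^ ((j : ℝ) - 1) * (θ - 1)) = A
      at h0 h1 ⊢
    split_ifs
    · have hA' : 0 < 1 - A := by linarith
      calc 1 + A / (1 - A) * 1 = (1 - A)⁻¹ := by field_simp; ring
        _ ≤ (1 - E)⁻¹ := inv_anti₀ hp (by linarith)
    · simpa using hone
  · intro j _
    split_ifs with h
    · exact Or.inr (inv_pow_succ_le_rpow_mul_rpow_neg hd hθ hc hp (by linarith) hr h)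
    · simp
end

section
/- Let \mu be a finite Borel measure on \mathbb{T}^d with nonempty support, let 0 < s < d, and assume the s-energy I_s(\mu) = \int\int \lVert x-y\rVert^{-s}\,d\mu(x)\,d\mu(y) is finite. Define the s-potential \phi_{s,\mu}(x) = \int \lVert x-y\rVert^{-s}\,d\mu(y) and the Borel measure \eta by \eta(A) = \int_A \big(\phi_{s,\mu}(x)\big)^{-1}\,d\mu(x) for Borel sets A. Then \eta(U) \le (\mathrm{diam}\,U)^s for every Borel set U \subset \mathbb{T}^d. -/
open MeasureTheory ENNReal

/-- Points of `U` are at distance at most `diam U` from each other, which bounds the `s`-potential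
below on `U`. -/
theorem ediam_rpow_neg_mul_measure_le_potential {X : Type*} [PseudoEMetricSpace X]
    [MeasurableSpace X] (μ : Measure X) {s : ℝ} (hs : 0 ≤ s) {U : Set X} (hU : MeasurableSet U)
    {x : X} (hx : x ∈ U) :
    Metric.ediam U ^ (-s) * μ U ≤ ∫⁻ y, edist x y ^ (-s) ∂μ :=
  calc Metric.ediam U ^ (-s) * μ U = ∫⁻ _ in U, Metric.ediam U ^ (-s) ∂μ :=
        (setLIntegral_const U _).symm
    _ ≤ ∫⁻ y in U, edist x y ^ (-s) ∂μ := setLIntegral_mono' hU fun y hy => by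
        rw [ENNReal.rpow_neg, ENNReal.rpow_neg]
        exact ENNReal.inv_le_inv.2
          (ENNReal.rpow_le_rpow (Metric.edist_le_ediam_of_mem hx hy) hs)
    _ ≤ ∫⁻ y, edist x y ^ (-s) ∂μ := setLIntegral_le_lintegral U _

theorem setLIntegral_inv_potential_le {X : Type*} [PseudoEMetricSpace X]
    [MeasurableSpace X] (μ : Measure X) [IsFiniteMeasure μ] {s : ℝ} (hs : 0 ≤ s) {U : Set X}
    (hU : MeasurableSet U) :
    ∫⁻ x in U, (∫⁻ y, edist x y ^ (-s) ∂μ)⁻¹ ∂μ ≤ Metric.ediam U ^ s := by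
  rcases eq_or_ne (μ U) 0 with h0 | h0
  · simp [setLIntegral_measure_zero U _ h0]
  calc ∫⁻ x in U, (∫⁻ y, edist x y ^ (-s) ∂μ)⁻¹ ∂μ
      ≤ ∫⁻ _ in U, (Metric.ediam U ^ (-s) * μ U)⁻¹ ∂μ := setLIntegral_mono' hU fun x hx =>
        ENNReal.inv_le_inv.2 (ediam_rpow_neg_mul_measure_le_potential μ hs hU hx)
    _ = Metric.ediam U ^ s * ((μ U)⁻¹ * μ U) := by
        rw [setLIntegral_const, ENNReal.mul_inv (.inr (measure_ne_top μ U)) (.inr h0),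
          ENNReal.rpow_neg, inv_inv, mul_assoc]
    _ = Metric.ediam U ^ s := by
        rw [ENNReal.inv_mul_cancel h0 (measure_ne_top μ U), mul_one]

/-- Lemma 6.8 (Lemma 4.4, after Persson): let `μ` be a nonzero finite Borel measure on the
`d`-torus `𝕋^d = (ℝ/ℤ)^d` (so that its support is nonempty), let `0 < s < d`, and assume the
`s`-energy `I_s(μ) = ∫∫ ‖x-y‖^{-s} dμ dμ` is finite. Then the measure
`η(A) = ∫_A (φ_{s,μ}(x))⁻¹ dμ(x)`, where `φ_{s,μ}(x) = ∫ ‖x-y‖^{-s} dμ(y)` is the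
`s`-potential, satisfies `η(U) ≤ (diam U)^s` for every Borel set `U`. -/
theorem stmt19 (d : ℕ) (hd : 1 ≤ d)
    (μ : Measure (Fin d → UnitAddCircle)) [IsFiniteMeasure μ] (hμ : μ ≠ 0)
    (s : ℝ) (hs0 : 0 < s) (hsd : s < d)
    (henergy : (∫⁻ x, ∫⁻ y, edist x y ^ (-s) ∂μ ∂μ) ≠ ⊤) :
    ∀ U : Set (Fin d → UnitAddCircle), MeasurableSet U →
      (∫⁻ x in U, (∫⁻ y, edist x y ^ (-s) ∂μ)⁻¹ ∂μ) ≤ EMetric.diam U ^ s := by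
  exact fun U hU => setLIntegral_inv_potential_le μ hs0.le hU
end
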